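/- arXiv:math/9412214 — 2 statements merged into one kernel-verified Lean document; each statement's English description precedes it below -/
import Mathlib

section
/- Let X be a rearrangement invariant quasi-Banach space on ℝ, let 0 < q ≤ ∞ and 0 < r < ∞. If the upper Boyd index satisfies q_X < q, then the Hardy operator H_{(q,r)} is bounded from X to X; that is, there exists a constant c > 0 such that ‖H_{(q,r)} f‖_X ≤ c ‖f‖_X for all f ∈ X. -/
open MeasureTheory Set Filter Topology ENNReal

noncomputable section

/-- The decreasing rearrangement of an `ℝ≥0∞`-valued function with respect to a measure `μ`:
`g⁎(s) = sup {t : μ {x | g x > t} > s}`. -/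
def distRearr {α : Type*} [MeasurableSpace α] (μ : Measure α) (g : α → ℝ≥0∞) (s : ℝ) : ℝ≥0∞ :=
  sSup {t : ℝ≥0∞ | ENNReal.ofReal s < μ {x | t < g x}}

/-- Decreasing rearrangement of an `ℝ≥0∞`-valued function on `ℝ` (Lebesgue measure). -/
def rearrE (g : ℝ → ℝ≥0∞) : ℝ → ℝ≥0∞ := distRearr (volume : Measure ℝ) g

/-- Decreasing rearrangement `f^*` of a real-valued function on `ℝ`:
`f^*(s) = sup {t ≥ 0 : volume {x : |f x| > t} > s}`. -/
def rearr (f : ℝ → ℝ) : ℝ → ℝ≥0∞ := rearrE fun x => ENNReal.ofReal |f x|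

/-- The dilation operator `D_a f (t) = f (a t)`. -/
def dil (a : ℝ) (f : ℝ → ℝ) : ℝ → ℝ := fun t => f (a * t)

/-- The dilation operator on `ℝ≥0∞`-valued functions. -/
def dilE (a : ℝ) (g : ℝ → ℝ≥0∞) : ℝ → ℝ≥0∞ := fun t => g (a * t)

/-- A rearrangement invariant quasi-Banach function space on `ℝ` (with Lebesgue measure).
The quasi-norm `N` is defined on all `ℝ≥0∞`-valued functions (a signed function `f`
is measured via `|f|`, embedded into `ℝ≥0∞`; this is harmless since the quasi-norm of a
rearrangement invariant space depends only on `|f|`).  Membership of a signed function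
`f` in the space means `f` is measurable with `N (|f|) < ∞`. -/
structure RIQB where
  /-- the quasi-norm -/
  N : (ℝ → ℝ≥0∞) → ℝ≥0∞
  /-- the quasi-triangle inequality constant -/
  C : ℝ
  one_le_C : 1 ≤ C
  /-- homogeneity of the quasi-norm -/
  norm_smul : ∀ (c : ℝ≥0∞) (g : ℝ → ℝ≥0∞), N (fun x => c * g x) = c * N g
  /-- the quasi-triangle inequality -/
  quasi_triangle : ∀ g h : ℝ → ℝ≥0∞, AEMeasurable g volume → AEMeasurable h volume →
    N (fun x => g x + h x) ≤ ENNReal.ofReal C * (N g + N h)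
  /-- definiteness (functions are identified a.e.) -/
  definite : ∀ g : ℝ → ℝ≥0∞, AEMeasurable g volume → (N g = 0 ↔ g =ᵐ[volume] 0)
  /-- property (i): if `h^* ≤ g^*` then `‖h‖ ≤ ‖g‖` -/
  rearr_mono : ∀ g h : ℝ → ℝ≥0∞, AEMeasurable g volume → AEMeasurable h volume →
    (∀ s : ℝ, 0 < s → rearrE h s ≤ rearrE g s) → N h ≤ N g
  /-- property (ii): simple functions with support of finite measure belong to the space -/
  simple_mem : ∀ f : MeasureTheory.SimpleFunc ℝ ℝ,
    volume (Function.support (f : ℝ → ℝ)) < ∞ → N (fun x => ENNReal.ofReal |f x|) < ∞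
  /-- property (iii) or (iii′) -/
  fatou :
    (∀ g : ℕ → ℝ → ℝ≥0∞, (∀ n, AEMeasurable (g n) volume ∧ N (g n) < ∞) →
      (∀ x, Antitone fun n => g n x) → (∀ x, Tendsto (fun n => g n x) atTop (𝓝 0)) →
      Tendsto (fun n => N (g n)) atTop (𝓝 0)) ∨
    (∀ (g : ℕ → ℝ → ℝ≥0∞) (h : ℝ → ℝ≥0∞),
      (∀ n, AEMeasurable (g n) volume ∧ N (g n) < ∞) →
      (∀ x, Monotone fun n => g n x) → (∀ x, Tendsto (fun n => g n x) atTop (𝓝 (h x))) →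
      (⨆ n, N (g n)) < ∞ → N h = ⨆ n, N (g n))
  /-- completeness of the quasi-norm -/
  complete : ∀ f : ℕ → ℝ → ℝ,
    (∀ n, AEMeasurable (f n) volume ∧ N (fun x => ENNReal.ofReal |f n x|) < ∞) →
    (∀ ε : ℝ, 0 < ε → ∃ M : ℕ, ∀ m ≥ M, ∀ n ≥ M,
      N (fun x => ENNReal.ofReal |f m x - f n x|) < ENNReal.ofReal ε) →
    ∃ g : ℝ → ℝ, AEMeasurable g volume ∧ N (fun x => ENNReal.ofReal |g x|) < ∞ ∧
      Tendsto (fun n => N (fun x => ENNReal.ofReal |f n x - g x|)) atTop (𝓝 0)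

/-- The quasi-norm of a signed function. -/
def RIQB.Nr (X : RIQB) (f : ℝ → ℝ) : ℝ≥0∞ := X.N fun x => ENNReal.ofReal |f x|

/-- Membership in the space. -/
def RIQB.mem (X : RIQB) (f : ℝ → ℝ) : Prop := AEMeasurable f volume ∧ X.Nr f < ∞

/-- The lower Boyd index of a quasi-norm functional:
`sup {p > 0 : ∃ c > 0, ∀ 0 < a < 1, ∀ f ∈ X, ‖D_a f‖ ≤ c a^(-1/p) ‖f‖}`. -/
def lowerBoydOf (N : (ℝ → ℝ) → ℝ≥0∞) : ℝ≥0∞ :=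
  ⨆ p ∈ {p : ℝ | 0 < p ∧ ∃ c : ℝ, 0 < c ∧ ∀ a : ℝ, 0 < a → a < 1 →
      ∀ f : ℝ → ℝ, AEMeasurable f volume → N f < ∞ →
        N (dil a f) ≤ ENNReal.ofReal (c * a ^ (-(1/p))) * N f},
    ENNReal.ofReal p

/-- The upper Boyd index of a quasi-norm functional:
`inf {q > 0 : ∃ c > 0, ∀ a > 1, ∀ f ∈ X, ‖D_a f‖ ≤ c a^(-1/q) ‖f‖}`. -/
def upperBoydOf (N : (ℝ → ℝ) → ℝ≥0∞) : ℝ≥0∞ :=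
  ⨅ q ∈ {q : ℝ | 0 < q ∧ ∃ c : ℝ, 0 < c ∧ ∀ a : ℝ, 1 < a →
      ∀ f : ℝ → ℝ, AEMeasurable f volume → N f < ∞ →
        N (dil a f) ≤ ENNReal.ofReal (c * a ^ (-(1/q))) * N f},
    ENNReal.ofReal q

/-- The lower Boyd index `p_X`. -/
def lowerBoyd (X : RIQB) : ℝ≥0∞ := lowerBoydOf X.Nr

/-- The upper Boyd index `q_X`. -/
def upperBoyd (X : RIQB) : ℝ≥0∞ := upperBoydOf X.Nr

/-- The Hardy operator `H^{(p,r)}` acting on a nonnegative (`ℝ≥0∞`-valued) function: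
`t^{-1/p} ((r/p) ∫₀ᵗ g(s)^r s^{r/p-1} ds)^{1/r}` for `t > 0`, and `0` for `t ≤ 0`. -/
def hardyUE (p r : ℝ) (g : ℝ → ℝ≥0∞) : ℝ → ℝ≥0∞ := fun t =>
  if 0 < t then
    ENNReal.ofReal t ^ (-(1/p)) *
      (ENNReal.ofReal (r/p) *
        ∫⁻ s in Ioo (0:ℝ) t, g s ^ r * ENNReal.ofReal (s ^ (r/p - 1))) ^ (1/r)
  else 0

/-- The Hardy operator `H^{(p,r)} f (t) = t^{-1/p} ((r/p) ∫₀ᵗ f^*(s)^r s^{r/p-1} ds)^{1/r}`. -/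
def hardyU (p r : ℝ) (f : ℝ → ℝ) : ℝ → ℝ≥0∞ := hardyUE p r (rearr f)

/-- The Hardy operator `H^{(p,∞)} f (t) = sup_{0<s<t} (s/t)^{1/p} f^*(s)`. -/
def hardyUSup (p : ℝ) (f : ℝ → ℝ) : ℝ → ℝ≥0∞ := fun t =>
  if 0 < t then ⨆ s ∈ Ioo (0:ℝ) t, ENNReal.ofReal ((s/t) ^ (1/p)) * rearr f s else 0

/-- The Hardy operator
`H_{(q,r)} f (t) = t^{-1/q} ((r/q) ∫_t^∞ f^*(s)^r s^{r/q-1} ds)^{1/r}` for finite `q`. -/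
def hardyL (q r : ℝ) (f : ℝ → ℝ) : ℝ → ℝ≥0∞ := fun t =>
  if 0 < t then
    ENNReal.ofReal t ^ (-(1/q)) *
      (ENNReal.ofReal (r/q) *
        ∫⁻ s in Ioi t, rearr f s ^ r * ENNReal.ofReal (s ^ (r/q - 1))) ^ (1/r)
  else 0

/-- The Hardy operator `H_{(∞,r)} f (t) = (∫_t^∞ f^*(s)^r s⁻¹ ds)^{1/r}`. -/
def hardyLInf (r : ℝ) (f : ℝ → ℝ) : ℝ → ℝ≥0∞ := fun t =>
  if 0 < t then (∫⁻ s in Ioi t, rearr f s ^ r * ENNReal.ofReal s⁻¹) ^ (1/r) else 0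

/-- The Hardy operator `H_{(q,r)}` for `0 < q ≤ ∞`, `0 < r < ∞`. -/
def hardyLG (q : ℝ≥0∞) (r : ℝ) (f : ℝ → ℝ) : ℝ → ℝ≥0∞ :=
  if q = ∞ then hardyLInf r f else hardyL q.toReal r f

/-- The Hardy operator `H_{(q,∞)} f (t) = sup_{s>t} (s/t)^{1/q} f^*(s)`. -/
def hardyLSup (q : ℝ) (f : ℝ → ℝ) : ℝ → ℝ≥0∞ := fun t =>
  if 0 < t then ⨆ s ∈ Ioi t, ENNReal.ofReal ((s/t) ^ (1/q)) * rearr f s else 0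

/-- The Hardy operator `H^{(p,r)}` for `0 < p < ∞`, `0 < r ≤ ∞`. -/
def hardyUG (p : ℝ) (r : ℝ≥0∞) (f : ℝ → ℝ) : ℝ → ℝ≥0∞ :=
  if r = ∞ then hardyUSup p f else hardyU p r.toReal f

/-- The Hardy operator `H_{(q,s)}` for `0 < q ≤ ∞`, `0 < s ≤ ∞`
(with `H_{(∞,∞)} f = f^*`). -/
def hardyLGG (q s : ℝ≥0∞) (f : ℝ → ℝ) : ℝ → ℝ≥0∞ :=
  if q = ∞ then
    (if s = ∞ then (fun t => if 0 < t then rearr f t else 0) else hardyLInf s.toReal f)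
  else
    (if s = ∞ then hardyLSup q.toReal f else hardyL q.toReal s.toReal f)

/-- The Lorentz quasi-norm `‖f‖_{p,r}` for `0 < p ≤ ∞`, `0 < r ≤ ∞`. -/
def lorentz (p r : ℝ≥0∞) (f : ℝ → ℝ) : ℝ≥0∞ :=
  if p = ∞ then
    (if r = ∞ then essSup (fun x => ENNReal.ofReal |f x|) volume
     else (∫⁻ t in Ioi (0:ℝ), rearr f t ^ r.toReal * ENNReal.ofReal t⁻¹) ^ (1/r.toReal))
  else
    (if r = ∞ then ⨆ t ∈ Ioi (0:ℝ), ENNReal.ofReal t ^ (1/p.toReal) * rearr f t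
     else (∫⁻ t in Ioi (0:ℝ),
        (ENNReal.ofReal t ^ (1/p.toReal) * rearr f t) ^ r.toReal * ENNReal.ofReal t⁻¹) ^
          (1/r.toReal))

/-- The weak-`L_p` (Lorentz `(p,∞)`) quasi-norm of an `ℝ≥0∞`-valued function on `ℝ`:
`sup_{t>0} t^{1/p} g^*(t)`. -/
def lorentzWE (p : ℝ) (g : ℝ → ℝ≥0∞) : ℝ≥0∞ :=
  ⨆ t ∈ Ioi (0:ℝ), ENNReal.ofReal t ^ (1/p) * rearrE g t

theorem rearrE_le_of_distribution_le {g h : ℝ → ℝ≥0∞}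
    (hgh : ∀ τ, volume {x | τ < h x} ≤ volume {x | τ < g x}) (s : ℝ) :
    rearrE h s ≤ rearrE g s :=
  sSup_le_sSup fun τ hτ => lt_of_lt_of_le hτ (hgh τ)

theorem antitone_rearr (f : ℝ → ℝ) : Antitone (rearr f) := fun _ _ hab =>
  sSup_le_sSup fun _ hτ => lt_of_le_of_lt (ENNReal.ofReal_le_ofReal hab) hτ

namespace RIQB

variable (X : RIQB)

theorem norm_le_of_distribution_le {g h : ℝ → ℝ≥0∞} (hg : AEMeasurable g volume)
    (hh : AEMeasurable h volume) (hgh : ∀ τ, volume {x | τ < h x} ≤ volume {x | τ < g x}) :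
    X.N h ≤ X.N g :=
  X.rearr_mono g h hg hh fun s _ => rearrE_le_of_distribution_le hgh s

theorem norm_mono_ae {g h : ℝ → ℝ≥0∞} (hg : AEMeasurable g volume)
    (hh : AEMeasurable h volume) (hgh : h ≤ᵐ[volume] g) : X.N h ≤ X.N g := by
  refine X.norm_le_of_distribution_le hg hh fun τ => measure_mono_ae ?_
  filter_upwards [hgh] with x hx hτ
  exact lt_of_lt_of_le hτ hx

theorem norm_zero : X.N (fun _ => 0) = 0 :=
  (X.definite _ aemeasurable_const).2 Filter.EventuallyEq.rfl

theorem one_le_ofReal_C : 1 ≤ ENNReal.ofReal X.C := ENNReal.one_le_ofReal.2 X.one_le_C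

theorem norm_sum_le_of_geometric (n : ℕ) (u : ℕ → ℝ → ℝ≥0∞) (M : ℝ≥0∞)
    (hu : ∀ k, AEMeasurable (u k) volume)
    (hM : ∀ k, X.N (u k) ≤ M * (2 * ENNReal.ofReal X.C)⁻¹ ^ k) :
    X.N (fun x => ∑ k ∈ Finset.range n, u k x) ≤ 2 * ENNReal.ofReal X.C * M := by
  have hD0 : 2 * ENNReal.ofReal X.C ≠ 0 :=
    mul_ne_zero two_ne_zero (ne_of_gt (lt_of_lt_of_le one_pos X.one_le_ofReal_C))
  have hDt : 2 * ENNReal.ofReal X.C ≠ ∞ := ENNReal.mul_ne_top (by simp) (by simp)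
  induction n generalizing u M with
  | zero => simp [X.norm_zero]
  | succ n ih =>
    simp only [Finset.sum_range_succ']
    refine (X.quasi_triangle _ _ (Finset.aemeasurable_fun_sum _ fun k _ => hu (k + 1))
      (hu 0)).trans ?_
    have h1 := ih (fun k => u (k + 1)) (M * (2 * ENNReal.ofReal X.C)⁻¹) (fun k => hu _)
      (fun k => (hM (k + 1)).trans (by rw [pow_succ']; ring_nf; exact le_rfl))
    have h2 : 2 * ENNReal.ofReal X.C * (M * (2 * ENNReal.ofReal X.C)⁻¹) = M := by
      rw [mul_comm M, ← mul_assoc, ENNReal.mul_inv_cancel hD0 hDt, one_mul]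
    rw [h2] at h1
    have h3 : X.N (u 0) ≤ M := by simpa using hM 0
    calc _ ≤ ENNReal.ofReal X.C * (M + M) := by gcongr
      _ = _ := by ring

/-- A Riesz–Fischer property: geometric decay of the quasi-norms controls the supremum. -/
theorem norm_iSup_le_of_geometric (g : ℕ → ℝ → ℝ) (M : ℝ≥0∞) (hMt : M < ∞)
    (hg : ∀ k, AEMeasurable (g k) volume) (hg0 : ∀ k x, 0 ≤ g k x)
    (hM : ∀ k, X.Nr (g k) ≤ M * (2 * ENNReal.ofReal X.C)⁻¹ ^ k) :
    X.N (fun x => ⨆ k, ENNReal.ofReal (g k x)) ≤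
      ENNReal.ofReal X.C * (2 * ENNReal.ofReal X.C * M) := by
  set D := ENNReal.ofReal X.C with hD
  have hDt : D ≠ ∞ := ENNReal.ofReal_ne_top
  have hD2 : (2 * D)⁻¹ ≤ 2⁻¹ := by
    rw [ENNReal.inv_le_inv]
    simpa using mul_le_mul_right X.one_le_ofReal_C 2
  set S : ℕ → ℝ → ℝ := fun n x => ∑ k ∈ Finset.range n, g k x with hS
  have hSm : ∀ n, AEMeasurable (S n) volume :=
    fun n => Finset.aemeasurable_fun_sum _ fun k _ => hg k
  have hgE : ∀ k, AEMeasurable (fun x => ENNReal.ofReal |g k x|) volume :=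
    fun k => (hg k).abs.ennreal_ofReal
  have hsum : ∀ (m n : ℕ) x, ENNReal.ofReal |∑ k ∈ Finset.range n, g (m + k) x| =
      ∑ k ∈ Finset.range n, ENNReal.ofReal |g (m + k) x| := by
    intro m n x
    rw [abs_of_nonneg (Finset.sum_nonneg fun k _ => hg0 _ x),
      ENNReal.ofReal_sum_of_nonneg fun k _ => hg0 _ x]
    simp only [abs_of_nonneg (hg0 _ x)]
  have hblock : ∀ m n : ℕ, X.N (fun x => ENNReal.ofReal |∑ k ∈ Finset.range n, g (m + k) x|) ≤
      2 * D * (M * 2⁻¹ ^ m) := by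
    intro m n
    simp only [hsum]
    refine (X.norm_sum_le_of_geometric n (fun k x => ENNReal.ofReal |g (m + k) x|)
      (M * (2 * D)⁻¹ ^ m) (fun k => hgE _) fun k => ?_).trans (by gcongr)
    refine (hM (m + k)).trans (by rw [pow_add, mul_assoc])
  have hSN : ∀ n, X.N (fun x => ENNReal.ofReal |S n x|) ≤ 2 * D * M := by
    intro n
    simpa [hS] using hblock 0 n
  have hfin : 2 * D * M < ∞ := ENNReal.mul_lt_top (ENNReal.mul_lt_top (by simp) hDt.lt_top) hMt
  have hdiff : ∀ m n, m ≤ n →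
      X.N (fun x => ENNReal.ofReal |S m x - S n x|) ≤ 2 * D * (M * 2⁻¹ ^ m) := by
    intro m n hmn
    obtain ⟨j, rfl⟩ := Nat.exists_eq_add_of_le hmn
    refine le_of_eq_of_le ?_ (hblock m j)
    congr 1
    ext x
    simp only [hS, Finset.sum_range_add]
    rw [abs_sub_comm, add_sub_cancel_left]
  have htend : Tendsto (fun m : ℕ => 2 * D * (M * 2⁻¹ ^ m)) atTop (𝓝 0) := by
    have h1 : Tendsto (fun m : ℕ => (2⁻¹ : ℝ≥0∞) ^ m) atTop (𝓝 0) :=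
      ENNReal.tendsto_pow_atTop_nhds_zero_of_lt_one (by simp)
    have h2 := ENNReal.Tendsto.const_mul (a := 2 * D * M) h1 (Or.inr hfin.ne)
    simpa [mul_assoc] using h2
  obtain ⟨G, hGm, -, hGlim⟩ := X.complete S (fun n => ⟨hSm n, (hSN n).trans_lt hfin⟩) (by
    intro ε hε
    obtain ⟨K, hK⟩ := eventually_atTop.1
      (htend.eventually (gt_mem_nhds (ENNReal.ofReal_pos.2 hε)))
    refine ⟨K, fun m hm n hn => ?_⟩
    rcases le_total m n with h | h
    · exact (hdiff m n h).trans_lt (hK m hm)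
    · simp only [abs_sub_comm (S m _)]
      exact (hdiff n m h).trans_lt (hK n hn))
  have hGE : AEMeasurable (fun x => ENNReal.ofReal |G x|) volume := hGm.abs.ennreal_ofReal
  have hSG : ∀ n, AEMeasurable (fun x => ENNReal.ofReal |S n x - G x|) volume :=
    fun n => ((hSm n).sub hGm).abs.ennreal_ofReal
  have hle : ∀ k, ∀ᵐ x ∂(volume : Measure ℝ), ENNReal.ofReal (g k x) ≤ ENNReal.ofReal |G x| := by
    intro k
    have hdm : AEMeasurable (fun x => ENNReal.ofReal (g k x) - ENNReal.ofReal |G x|) volume :=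
      (hg k).ennreal_ofReal.sub hGE
    have hz : X.N (fun x => ENNReal.ofReal (g k x) - ENNReal.ofReal |G x|) = 0 := by
      refine le_antisymm (ge_of_tendsto hGlim ?_) zero_le
      filter_upwards [eventually_gt_atTop k] with n hn
      refine X.norm_mono_ae (hSG n) hdm (Eventually.of_forall fun x => ?_)
      have h1 : g k x ≤ S n x :=
        Finset.single_le_sum (f := fun k => g k x) (fun i _ => hg0 i x) (Finset.mem_range.2 hn)
      have h2 : g k x - |G x| ≤ |S n x - G x| := by
        linarith [le_abs_self (S n x - G x), le_abs_self (G x)]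
      show ENNReal.ofReal (g k x) - ENNReal.ofReal |G x| ≤ _
      rw [← ENNReal.ofReal_sub _ (abs_nonneg _)]
      exact ENNReal.ofReal_le_ofReal h2
    filter_upwards [(X.definite _ hdm).1 hz] with x hx
    exact tsub_eq_zero_iff_le.1 hx
  have hsup : X.N (fun x => ⨆ k, ENNReal.ofReal (g k x)) ≤ X.N fun x => ENNReal.ofReal |G x| := by
    refine X.norm_mono_ae hGE (AEMeasurable.iSup fun k => (hg k).ennreal_ofReal) ?_
    filter_upwards [ae_all_iff.2 hle] with x hx
    exact iSup_le hx
  refine hsup.trans ?_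
  have hlim : Tendsto (fun n => D * (2 * D * M + X.N (fun x => ENNReal.ofReal |S n x - G x|)))
      atTop (𝓝 (D * (2 * D * M + 0))) :=
    ENNReal.Tendsto.const_mul (hGlim.const_add _) (Or.inr hDt)
  rw [add_zero] at hlim
  refine ge_of_tendsto' hlim fun n => ?_
  calc X.N (fun x => ENNReal.ofReal |G x|)
      ≤ X.N (fun x => ENNReal.ofReal |S n x| + ENNReal.ofReal |S n x - G x|) := by
        refine X.norm_mono_ae ((hSm n).abs.ennreal_ofReal.add (hSG n)) hGE
          (Eventually.of_forall fun x => ?_)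
        show ENNReal.ofReal |G x| ≤ ENNReal.ofReal |S n x| + ENNReal.ofReal |S n x - G x|
        rw [← ENNReal.ofReal_add (abs_nonneg _) (abs_nonneg _)]
        refine ENNReal.ofReal_le_ofReal ?_
        have := abs_sub (S n x) (S n x - G x)
        simpa using this
    _ ≤ D * (X.N (fun x => ENNReal.ofReal |S n x|) +
          X.N (fun x => ENNReal.ofReal |S n x - G x|)) :=
        X.quasi_triangle _ _ (hSm n).abs.ennreal_ofReal (hSG n)
    _ ≤ _ := by gcongr; exact hSN n

theorem rearr_lt_top {f : ℝ → ℝ} (hf : X.mem f) {t : ℝ} (ht : 0 < t) : rearr f t < ∞ := by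
  by_contra hcon
  have hR : rearr f t = ∞ := not_lt_top_iff.1 hcon
  have hlarge : ∀ τ : ℝ≥0∞, τ < ∞ →
      ENNReal.ofReal t < volume {x | τ < ENNReal.ofReal |f x|} := by
    intro τ hτ
    rw [← hR] at hτ
    obtain ⟨τ', hτ', hlt⟩ := lt_sSup_iff.1 hτ
    exact lt_of_lt_of_le hτ' (measure_mono fun x hx => hlt.trans hx)
  set u : ℝ → ℝ≥0∞ := (Ioo 0 t).indicator 1 with hu
  have hum : AEMeasurable u volume := (measurable_one.indicator measurableSet_Ioo).aemeasurable
  have hu0 : X.N u ≠ 0 := by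
    rw [Ne, X.definite u hum, indicator_ae_eq_zero]
    simp [ht]
  have hle : X.N (fun x => ∞ * u x) ≤ X.Nr f := by
    refine X.norm_le_of_distribution_le hf.1.abs.ennreal_ofReal (hum.const_mul _) fun τ => ?_
    rcases eq_or_ne τ ∞ with rfl | hτ
    · simp
    · refine le_trans (measure_mono (t := Ioo 0 t) fun x hx => ?_) (le_of_lt ?_) (b := volume (Ioo 0 t))
      · by_contra hxt
        simp [hu, hxt] at hx
      · simpa using hlarge τ hτ.lt_top
  rw [X.norm_smul, ENNReal.top_mul hu0] at hle
  exact absurd hf.2 (by rw [top_le_iff.1 hle]; exact lt_irrefl _)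

end RIQB

/-- The decreasing rearrangement on the positive half-line, as a real-valued function on `ℝ`. -/
def rearrPos (f : ℝ → ℝ) : ℝ → ℝ := (Ioi 0).indicator fun t => (rearr f t).toReal

theorem rearrPos_nonneg (f : ℝ → ℝ) (t : ℝ) : 0 ≤ rearrPos f t :=
  indicator_nonneg (fun _ _ => ENNReal.toReal_nonneg) t

theorem measurable_rearrPos (f : ℝ → ℝ) : Measurable (rearrPos f) :=
  (antitone_rearr f).measurable.ennreal_toReal.indicator measurableSet_Ioi

theorem RIQB.ofReal_rearrPos (X : RIQB) {f : ℝ → ℝ} (hf : X.mem f) {t : ℝ} (ht : 0 < t) :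
    ENNReal.ofReal (rearrPos f t) = rearr f t := by
  rw [rearrPos, indicator_of_mem (mem_Ioi.2 ht), ENNReal.ofReal_toReal (X.rearr_lt_top hf ht).ne]

theorem RIQB.Nr_rearrPos_le (X : RIQB) {f : ℝ → ℝ} (hf : X.mem f) :
    X.Nr (rearrPos f) ≤ X.Nr f := by
  refine X.norm_le_of_distribution_le hf.1.abs.ennreal_ofReal
    (measurable_rearrPos f).abs.ennreal_ofReal.aemeasurable fun τ => ?_
  have hsub : {x | τ < ENNReal.ofReal |rearrPos f x|} ⊆
      {x | 0 < x ∧ ENNReal.ofReal x < volume {y | τ < ENNReal.ofReal |f y|}} := by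
    intro x hx
    have hx' : τ < ENNReal.ofReal |rearrPos f x| := hx
    rw [abs_of_nonneg (rearrPos_nonneg f x)] at hx'
    have hx0 : 0 < x := by
      by_contra hn
      simp [rearrPos, hn] at hx'
    rw [X.ofReal_rearrPos hf hx0] at hx'
    obtain ⟨τ', hτ', hlt⟩ := lt_sSup_iff.1 hx'
    exact ⟨hx0, lt_of_lt_of_le hτ' (measure_mono fun y hy => hlt.trans hy)⟩
  rcases eq_or_ne (volume {y | τ < ENNReal.ofReal |f y|}) ∞ with h | h
  · rw [h]; exact le_top
  · have hIoo : {x | τ < ENNReal.ofReal |rearrPos f x|} ⊆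
        Ioo 0 (volume {y | τ < ENNReal.ofReal |f y|}).toReal := fun x hx =>
      ⟨(hsub hx).1, (ENNReal.ofReal_lt_iff_lt_toReal (hsub hx).1.le h).1 (hsub hx).2⟩
    refine (measure_mono hIoo).trans ?_
    rw [Real.volume_Ioo, sub_zero, ENNReal.ofReal_toReal h]

/-- A common form of the Hardy operators `H_{(q,r)}`, with `e = 1/q`, for finite and infinite `q`. -/
def hardyTail (κ : ℝ≥0∞) (e r : ℝ) (R : ℝ → ℝ≥0∞) : ℝ → ℝ≥0∞ := (Ioi 0).indicator fun t =>
  ENNReal.ofReal t ^ (-e) *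
    (κ * ∫⁻ s in Ioi t, R s ^ r * ENNReal.ofReal (s ^ (e * r - 1))) ^ (1 / r)

theorem measurable_hardyTail (κ : ℝ≥0∞) (e r : ℝ) (R : ℝ → ℝ≥0∞) :
    Measurable (hardyTail κ e r R) := by
  have hanti : Antitone fun t : ℝ =>
      ∫⁻ s in Ioi t, R s ^ r * ENNReal.ofReal (s ^ (e * r - 1)) :=
    fun a b hab => lintegral_mono_set (Ioi_subset_Ioi hab)
  exact ((ENNReal.measurable_ofReal.pow_const _).mul
    ((hanti.measurable.const_mul κ).pow_const _)).indicator measurableSet_Ioi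

theorem hardyLG_eq_hardyTail (q : ℝ≥0∞) (r : ℝ) (f : ℝ → ℝ) :
    hardyLG q r f = hardyTail (if q = ∞ then 1 else ENNReal.ofReal (r / q.toReal))
      (1 / q.toReal) r (rearr f) := by
  ext t
  by_cases hq : q = ∞ <;> by_cases ht : 0 < t
  · simp [hardyLG, hq, hardyLInf, ht, hardyTail, Real.rpow_neg_one]
  · simp [hardyLG, hq, hardyLInf, ht, hardyTail]
  · simp [hardyLG, hq, hardyL, ht, hardyTail, div_eq_inv_mul]
  · simp [hardyLG, hq, hardyL, ht, hardyTail]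

theorem Ioi_subset_iUnion_Ico_pow {A t : ℝ} (hA : 1 < A) (ht : 0 < t) :
    Ioi t ⊆ ⋃ n : ℕ, Ico (A ^ n * t) (A ^ (n + 1) * t) := by
  intro s hs
  obtain ⟨n, hn1, hn2⟩ := exists_nat_pow_near ((one_le_div ht).2 (le_of_lt hs)) hA
  exact mem_iUnion.2 ⟨n, (le_div_iff₀ ht).1 hn1, (div_lt_iff₀ ht).1 hn2⟩

theorem lintegral_tail_le_tsum {R : ℝ → ℝ≥0∞} (hR : Antitone R) {e r A t : ℝ} (he : 0 ≤ e)
    (hr : 0 < r) (hA : 1 < A) (ht : 0 < t) :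
    ∫⁻ s in Ioi t, R s ^ r * ENNReal.ofReal (s ^ (e * r - 1)) ≤
      ∑' n : ℕ, R (A ^ n * t) ^ r *
        ENNReal.ofReal ((A ^ (n + 1) * t) ^ (e * r) * (A - 1)) := by
  refine (lintegral_mono_set (Ioi_subset_iUnion_Ico_pow hA ht)).trans
    ((lintegral_iUnion_le _ _).trans (ENNReal.tsum_le_tsum fun n => ?_))
  have hpos : 0 < A ^ n * t := by positivity
  have hbound : ∀ s ∈ Ico (A ^ n * t) (A ^ (n + 1) * t),
      R s ^ r * ENNReal.ofReal (s ^ (e * r - 1)) ≤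
        R (A ^ n * t) ^ r *
          ENNReal.ofReal ((A ^ (n + 1) * t) ^ (e * r) * (A ^ n * t)⁻¹) := by
    intro s hs
    have hs0 : 0 < s := hpos.trans_le hs.1
    refine mul_le_mul' (ENNReal.rpow_le_rpow (hR hs.1) hr.le) (ENNReal.ofReal_le_ofReal ?_)
    rw [Real.rpow_sub_one hs0.ne', div_eq_mul_inv]
    have h1 := hs.1
    have h2 := hs.2.le
    gcongr
  refine (setLIntegral_mono' measurableSet_Ico hbound).trans ?_
  rw [setLIntegral_const, Real.volume_Ico, mul_assoc, ← ENNReal.ofReal_mul (by positivity)]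
  refine mul_le_mul_right (ENNReal.ofReal_le_ofReal (le_of_eq ?_)) _
  field_simp
  ring

theorem hardyTail_le_iSup {R : ℝ → ℝ≥0∞} (hR : Antitone R) (κ : ℝ≥0∞) {e r A t : ℝ}
    (he : 0 ≤ e) (hr : 0 < r) (hA : 1 < A) (ht : 0 < t) :
    hardyTail κ e r R t ≤ (κ * (ENNReal.ofReal (A ^ (e * r) * (A - 1)) * 2)) ^ (1 / r) *
      ⨆ n : ℕ, ENNReal.ofReal ((2 ^ (1 / r) * A ^ e) ^ n) * R (A ^ n * t) := by
  set W := ⨆ n : ℕ, ENNReal.ofReal ((2 ^ (1 / r) * A ^ e) ^ n) * R (A ^ n * t) with hW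
  have hA0 : 0 < A := by linarith
  have hterm : ∀ n : ℕ, R (A ^ n * t) ^ r *
      ENNReal.ofReal ((A ^ (n + 1) * t) ^ (e * r) * (A - 1)) ≤
      (ENNReal.ofReal (A ^ (e * r) * (A - 1)) * ENNReal.ofReal (t ^ (e * r)) * W ^ r) *
        2⁻¹ ^ n := by
    intro n
    have h1 : ENNReal.ofReal (2 ^ n * (A ^ n) ^ (e * r)) * R (A ^ n * t) ^ r ≤ W ^ r := by
      have h2 := ENNReal.rpow_le_rpow
        (le_iSup (fun n : ℕ => ENNReal.ofReal ((2 ^ (1 / r) * A ^ e) ^ n) * R (A ^ n * t)) n)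
        hr.le
      rw [ENNReal.mul_rpow_of_nonneg _ _ hr.le,
        ENNReal.ofReal_rpow_of_nonneg (by positivity) hr.le] at h2
      refine le_of_eq_of_le ?_ h2
      congr 2
      rw [mul_pow, Real.mul_rpow (by positivity) (by positivity), ← Real.rpow_natCast (2 ^ (1 / r)),
        ← Real.rpow_natCast (A ^ e), ← Real.rpow_natCast 2, ← Real.rpow_natCast A,
        ← Real.rpow_mul hA0.le, ← Real.rpow_mul hA0.le, ← Real.rpow_mul hA0.le,
        ← Real.rpow_mul zero_le_two, ← Real.rpow_mul zero_le_two]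
      congr 2
      · field_simp
      · ring
    have h3 : ENNReal.ofReal ((A ^ (n + 1) * t) ^ (e * r) * (A - 1)) =
        ENNReal.ofReal (A ^ (e * r) * (A - 1)) * ENNReal.ofReal (t ^ (e * r)) *
          (ENNReal.ofReal (2 ^ n * (A ^ n) ^ (e * r)) * 2⁻¹ ^ n) := by
      have h4 : (2⁻¹ : ℝ≥0∞) ^ n = ENNReal.ofReal (2⁻¹ ^ n) := by
        rw [ENNReal.ofReal_pow (by norm_num), ENNReal.ofReal_inv_of_pos two_pos]; simp
      have hA1 : 0 ≤ A - 1 := by linarith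
      rw [h4, ← ENNReal.ofReal_mul (by positivity), ← ENNReal.ofReal_mul (by positivity),
        ← ENNReal.ofReal_mul (by positivity)]
      congr 1
      rw [pow_succ, Real.mul_rpow (by positivity) ht.le, Real.mul_rpow (by positivity) hA0.le,
        inv_pow]
      field_simp
    rw [h3]
    calc _ = (ENNReal.ofReal (A ^ (e * r) * (A - 1)) * ENNReal.ofReal (t ^ (e * r)) *
          (ENNReal.ofReal (2 ^ n * (A ^ n) ^ (e * r)) * R (A ^ n * t) ^ r)) * 2⁻¹ ^ n := by ring
      _ ≤ _ := by gcongr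
  have hint : ∫⁻ s in Ioi t, R s ^ r * ENNReal.ofReal (s ^ (e * r - 1)) ≤
      (ENNReal.ofReal (A ^ (e * r) * (A - 1)) * ENNReal.ofReal (t ^ (e * r)) * W ^ r) * 2 := by
    refine (lintegral_tail_le_tsum hR he hr hA ht).trans
      ((ENNReal.tsum_le_tsum hterm).trans (le_of_eq ?_))
    rw [ENNReal.tsum_mul_left, ENNReal.tsum_geometric, ENNReal.one_sub_inv_two, inv_inv]
  have htE : ENNReal.ofReal t ≠ 0 := (ENNReal.ofReal_pos.2 ht).ne'
  rw [hardyTail, indicator_of_mem (mem_Ioi.2 ht)]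
  calc _ ≤ ENNReal.ofReal t ^ (-e) * (κ * ((ENNReal.ofReal (A ^ (e * r) * (A - 1)) *
        ENNReal.ofReal (t ^ (e * r)) * W ^ r) * 2)) ^ (1 / r) := by gcongr
    _ = ENNReal.ofReal t ^ (-e) * ((κ * (ENNReal.ofReal (A ^ (e * r) * (A - 1)) * 2)) *
        (ENNReal.ofReal t ^ (e * r) * W ^ r)) ^ (1 / r) := by
      rw [← ENNReal.ofReal_rpow_of_pos (p := e * r) ht]
      congr 2
      ring
    _ = ENNReal.ofReal t ^ (-e) * ((κ * (ENNReal.ofReal (A ^ (e * r) * (A - 1)) * 2)) ^ (1 / r) *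
        (ENNReal.ofReal t ^ e * W)) := by
      have hr' : (0 : ℝ) ≤ 1 / r := by positivity
      rw [ENNReal.mul_rpow_of_nonneg _ _ hr', ENNReal.mul_rpow_of_nonneg (_ ^ (e * r)) _ hr',
        ← ENNReal.rpow_mul, ← ENNReal.rpow_mul, mul_assoc, mul_one_div_cancel hr.ne', mul_one,
        ENNReal.rpow_one]
    _ = (ENNReal.ofReal t ^ (-e) * ENNReal.ofReal t ^ e) *
        ((κ * (ENNReal.ofReal (A ^ (e * r) * (A - 1)) * 2)) ^ (1 / r) * W) := by ring
    _ = _ := by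
      rw [← ENNReal.rpow_add _ _ htE ENNReal.ofReal_ne_top, neg_add_cancel, ENNReal.rpow_zero,
        one_mul]

theorem exists_ratio_of_upperBoyd_lt (X : RIQB) {q : ℝ≥0∞} (hqX : upperBoyd X < q)
    {ε B : ℝ} (hε : 0 < ε) (hB : 0 ≤ B) :
    ∃ A c : ℝ, 1 < A ∧ ∀ f : ℝ → ℝ, X.mem f → ∀ n : ℕ,
      X.Nr (fun t => (B * A ^ (1 / q.toReal)) ^ n * f (A ^ n * t)) ≤
        ENNReal.ofReal (c * ε ^ n) * X.Nr f := by
  obtain ⟨p, ⟨hp, c, hc, hdil⟩, hpq⟩ :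
      ∃ p ∈ {p : ℝ | 0 < p ∧ ∃ c : ℝ, 0 < c ∧ ∀ a : ℝ, 1 < a →
        ∀ f : ℝ → ℝ, AEMeasurable f volume → X.Nr f < ∞ →
          X.Nr (dil a f) ≤ ENNReal.ofReal (c * a ^ (-(1/p))) * X.Nr f},
        ENNReal.ofReal p < q := by
    simpa only [upperBoyd, upperBoydOf, iInf_lt_iff, exists_prop] using hqX
  set e := 1 / q.toReal with he
  have hep : e < 1 / p := by
    rcases eq_or_ne q ∞ with rfl | hqt
    · simpa [he] using hp
    · exact one_div_lt_one_div_of_lt hp ((ENNReal.ofReal_lt_iff_lt_toReal hp.le hqt).1 hpq)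
  have htend : Tendsto (fun A : ℝ => B * A ^ (-(1 / p - e))) atTop (𝓝 0) := by
    simpa using (tendsto_rpow_neg_atTop (sub_pos.2 hep)).const_mul B
  obtain ⟨A, hAε, hA⟩ := ((htend.eventually (gt_mem_nhds hε)).and (eventually_gt_atTop 1)).exists
  have hA0 : 0 < A := by linarith
  refine ⟨A, max c 1, hA, fun f hf n => ?_⟩
  have hfactor : X.Nr (fun t => (B * A ^ e) ^ n * f (A ^ n * t)) =
      ENNReal.ofReal ((B * A ^ e) ^ n) * X.Nr (dil (A ^ n) f) := by
    rw [RIQB.Nr, RIQB.Nr, ← X.norm_smul]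
    congr 1
    ext t
    rw [abs_mul, ENNReal.ofReal_mul (abs_nonneg _), abs_of_nonneg (by positivity), dil]
  have hd : X.Nr (dil (A ^ n) f) ≤
      ENNReal.ofReal (max c 1 * (A ^ n) ^ (-(1 / p))) * X.Nr f := by
    rcases Nat.eq_zero_or_pos n with rfl | hn
    · have h1 : dil (A ^ 0) f = f := by ext t; simp [dil]
      rw [h1]
      refine le_mul_of_one_le_left zero_le ?_
      simp
    · refine (hdil _ (one_lt_pow₀ hA hn.ne') f hf.1 hf.2).trans ?_
      gcongr
      exact le_max_left _ _
  rw [hfactor]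
  refine (mul_le_mul_right hd _).trans ?_
  rw [← mul_assoc, ← ENNReal.ofReal_mul (by positivity)]
  refine mul_le_mul_left (ENNReal.ofReal_le_ofReal ?_) _
  calc (B * A ^ e) ^ n * (max c 1 * (A ^ n) ^ (-(1 / p)))
      = max c 1 * (B * A ^ (-(1 / p - e))) ^ n := by
        rw [show -(1 / p - e) = e + -(1 / p) by ring, Real.rpow_add hA0, ← Real.rpow_pow_comm hA0.le]
        ring
    _ ≤ max c 1 * ε ^ n := by gcongr

/-- **Theorem 2 (ii), sufficiency.** If `q_X < q` (with `0 < q ≤ ∞`) then `H_{(q,r)}`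
is bounded on `X`. -/
theorem hardyL_bounded_of_upperBoyd_lt (X : RIQB) (q : ℝ≥0∞) (r : ℝ) (hq : 0 < q)
    (hr : 0 < r) (hqX : upperBoyd X < q) :
    ∃ c : ℝ, 0 < c ∧ ∀ f : ℝ → ℝ, X.mem f →
      X.N (hardyLG q r f) ≤ ENNReal.ofReal c * X.Nr f := by
  have hC : 0 < X.C := one_pos.trans_le X.one_le_C
  obtain ⟨A, c, hA, hratio⟩ := exists_ratio_of_upperBoyd_lt X hqX
    (ε := (2 * X.C)⁻¹) (B := 2 ^ (1 / r)) (by positivity) (by positivity)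
  set κ : ℝ≥0∞ := if q = ∞ then 1 else ENNReal.ofReal (r / q.toReal) with hκ
  set e := 1 / q.toReal with he
  have he0 : 0 ≤ e := by positivity
  have hκt : κ ≠ ∞ := by rw [hκ]; split_ifs <;> simp
  set K : ℝ≥0∞ := (κ * (ENNReal.ofReal (A ^ (e * r) * (A - 1)) * 2)) ^ (1 / r) with hK
  have hKt : K ≠ ∞ := ENNReal.rpow_ne_top_of_nonneg (by positivity)
    (ENNReal.mul_ne_top hκt (ENNReal.mul_ne_top ENNReal.ofReal_ne_top (by simp)))
  set L : ℝ≥0∞ := K * (ENNReal.ofReal X.C * (2 * ENNReal.ofReal X.C * ENNReal.ofReal c)) with hL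
  have hLt : L ≠ ∞ := by finiteness
  refine ⟨L.toReal + 1, by positivity, fun f hf => ?_⟩
  have hA0 : 0 < A := by linarith
  have hF : X.mem (rearrPos f) :=
    ⟨(measurable_rearrPos f).aemeasurable, (X.Nr_rearrPos_le hf).trans_lt hf.2⟩
  set g : ℕ → ℝ → ℝ := fun n t => (2 ^ (1 / r) * A ^ e) ^ n * rearrPos f (A ^ n * t) with hg
  have hgm : ∀ n, Measurable (g n) := fun n =>
    ((measurable_rearrPos f).comp (measurable_const_mul _)).const_mul _
  have hgN : ∀ n, X.Nr (g n) ≤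
      ENNReal.ofReal c * X.Nr f * (2 * ENNReal.ofReal X.C)⁻¹ ^ n := by
    intro n
    refine (hratio _ hF n).trans ((mul_le_mul_right (X.Nr_rearrPos_le hf) _).trans (le_of_eq ?_))
    rw [ENNReal.ofReal_mul' (by positivity), ENNReal.ofReal_pow (by positivity),
      ENNReal.ofReal_inv_of_pos (by positivity), ENNReal.ofReal_mul zero_le_two,
      ENNReal.ofReal_ofNat]
    ring
  have hsup := X.norm_iSup_le_of_geometric g (ENNReal.ofReal c * X.Nr f)
    (ENNReal.mul_lt_top ENNReal.ofReal_lt_top hf.2) (fun n => (hgm n).aemeasurable)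
    (fun n t => mul_nonneg (by positivity) (rearrPos_nonneg f _)) hgN
  have hpt : ∀ t, hardyTail κ e r (rearr f) t ≤ K * ⨆ n, ENNReal.ofReal (g n t) := by
    intro t
    by_cases ht : 0 < t
    · refine (hardyTail_le_iSup (antitone_rearr f) κ he0 hr hA ht).trans (le_of_eq ?_)
      congr 2
      ext n
      rw [hg, ENNReal.ofReal_mul (by positivity), X.ofReal_rearrPos hf (by positivity)]
    · simp [hardyTail, ht]
  rw [hardyLG_eq_hardyTail]
  calc X.N (hardyTail κ e r (rearr f))
      ≤ X.N (fun t => K * ⨆ n, ENNReal.ofReal (g n t)) :=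
        X.norm_mono_ae ((Measurable.iSup fun n => (hgm n).ennreal_ofReal).const_mul K).aemeasurable
          (measurable_hardyTail _ _ _ _).aemeasurable (Eventually.of_forall hpt)
    _ = K * X.N (fun t => ⨆ n, ENNReal.ofReal (g n t)) := X.norm_smul _ _
    _ ≤ K * (ENNReal.ofReal X.C * (2 * ENNReal.ofReal X.C * (ENNReal.ofReal c * X.Nr f))) := by
        gcongr
    _ = L * X.Nr f := by rw [hL]; ring
    _ ≤ ENNReal.ofReal (L.toReal + 1) * X.Nr f := by
        gcongr
        rw [← ENNReal.ofReal_toReal hLt]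
        exact ENNReal.ofReal_le_ofReal (by simp)

end
end

section
/- Let X be a rearrangement invariant quasi-Banach space on ℝ and let 0 < p < ∞. If the lower Boyd index satisfies p_X > p, then the operator H^{(p,∞)} is bounded from X to X; that is, there exists a constant c > 0 such that ‖H^{(p,∞)} f‖_X ≤ c ‖f‖_X for all f ∈ X. -/
open MeasureTheory Set Filter Topology ENNReal

noncomputable section

lemma rearrE_antitone (g : ℝ → ℝ≥0∞) : Antitone (rearrE g) := fun _ _ hst =>
  sSup_le_sSup fun _ ht => (ENNReal.ofReal_le_ofReal hst).trans_lt ht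

lemma rearrE_le_of_measure_le {g h : ℝ → ℝ≥0∞}
    (hgh : ∀ t, volume {x | t < h x} ≤ volume {x | t < g x}) (s : ℝ) :
    rearrE h s ≤ rearrE g s :=
  sSup_le_sSup fun t ht => lt_of_lt_of_le ht (hgh t)

lemma measure_lt_of_lt_rearrE {g : ℝ → ℝ≥0∞} {s : ℝ} {t : ℝ≥0∞} (ht : t < rearrE g s) :
    ENNReal.ofReal s < volume {x | t < g x} := by
  obtain ⟨t', ht', htt'⟩ := lt_sSup_iff.1 ht
  exact lt_of_lt_of_le ht' (measure_mono fun x hx => htt'.trans hx)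

lemma volume_pos_ofReal_lt_le (m : ℝ≥0∞) :
    volume {x : ℝ | 0 < x ∧ ENNReal.ofReal x < m} ≤ m := by
  rcases eq_or_ne m ∞ with rfl | hm
  · exact le_top
  · calc volume {x : ℝ | 0 < x ∧ ENNReal.ofReal x < m}
        ≤ volume (Ioo 0 m.toReal) := measure_mono fun x hx =>
          ⟨hx.1, (ENNReal.ofReal_lt_iff_lt_toReal hx.1.le hm).1 hx.2⟩
      _ = m := by simp [hm]

/-- The rearrangement, cut off to the positive half-line, is rearranged below `g`. -/
lemma volume_lt_rearrE_le (g : ℝ → ℝ≥0∞) (t : ℝ≥0∞) :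
    volume {x : ℝ | 0 < x ∧ t < rearrE g x} ≤ volume {x | t < g x} :=
  le_trans (measure_mono fun _ (hx : _ ∧ _) => And.intro hx.1 (measure_lt_of_lt_rearrE hx.2))
    (volume_pos_ofReal_lt_le _)

namespace RIQB

lemma N_mono_ae (X : RIQB) {g h : ℝ → ℝ≥0∞} (hg : AEMeasurable g volume)
    (hh : AEMeasurable h volume) (hle : h ≤ᵐ[volume] g) : X.N h ≤ X.N g :=
  X.rearr_mono g h hg hh fun s _ => rearrE_le_of_measure_le (fun _ => measure_mono_ae <| by
    filter_upwards [hle] with x hx ht using lt_of_lt_of_le ht hx) s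

lemma N_zero (X : RIQB) : X.N (fun _ => 0) = 0 := by
  simpa using X.norm_smul 0 (fun _ => 0)

lemma rearrE_lt_top (X : RIQB) {g : ℝ → ℝ≥0∞} (hg : AEMeasurable g volume)
    (hN : X.N g < ∞) {s : ℝ} (hs : 0 < s) : rearrE g s < ∞ := by
  by_contra htop
  have htop : rearrE g s = ∞ := not_lt_top_iff.1 htop
  let u : ℝ → ℝ≥0∞ := (Ioo 0 s).indicator fun _ => 1
  have hu : AEMeasurable u volume := (measurable_const.indicator measurableSet_Ioo).aemeasurable
  have hle : X.N (fun x => ∞ * u x) ≤ X.N g := by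
    refine X.rearr_mono g _ hg (hu.const_mul _) fun r _ => rearrE_le_of_measure_le (fun t => ?_) r
    rcases eq_or_ne t ∞ with rfl | ht
    · simp
    · calc volume {x | t < ∞ * u x} ≤ volume (Ioo 0 s) := measure_mono fun x hx => by
            by_contra hxs
            simp [u, hxs] at hx
        _ = ENNReal.ofReal s := by simp
        _ ≤ volume {x | t < g x} := (measure_lt_of_lt_rearrE (by
            rw [htop]; exact lt_top_iff_ne_top.2 ht)).le
  rw [X.norm_smul] at hle
  have hzero : X.N u = 0 := by
    by_contra h0
    rw [ENNReal.top_mul h0] at hle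
    exact absurd hN (not_lt.2 hle)
  have hae := (X.definite u hu).1 hzero
  have hvol : volume (Ioo 0 s) = 0 := by
    refine measure_mono_null (fun x hx => ?_) (ae_iff.1 hae)
    simp [u, hx.1, hx.2]
  simp [hs.not_ge] at hvol

lemma N_sum_range_le (X : RIQB) {G : ℕ → ℝ → ℝ} (hG : ∀ n, AEMeasurable (G n) volume)
    (hG0 : ∀ n x, 0 ≤ G n x) {K : ℝ≥0∞}
    (hK : ∀ n, X.Nr (G n) ≤ ENNReal.ofReal ((2 * X.C)⁻¹ ^ n) * K) (k m : ℕ) :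
    X.Nr (fun x => ∑ i ∈ Finset.range k, G (m + i) x) ≤
      ENNReal.ofReal (2 * X.C * (2 * X.C)⁻¹ ^ m) * K := by
  have hC := X.one_le_C
  induction k generalizing m with
  | zero => simp [Nr, X.N_zero]
  | succ k ih =>
    have hsum0 (x) : 0 ≤ ∑ i ∈ Finset.range k, G (m + 1 + i) x :=
      Finset.sum_nonneg fun i _ => hG0 _ x
    have hmeas : AEMeasurable (fun x => ∑ i ∈ Finset.range k, G (m + 1 + i) x) volume :=
      Finset.aemeasurable_fun_sum _ fun i _ => hG _
    calc X.Nr (fun x => ∑ i ∈ Finset.range (k + 1), G (m + i) x)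
        = X.N (fun x => ENNReal.ofReal |G m x| +
            ENNReal.ofReal |∑ i ∈ Finset.range k, G (m + 1 + i) x|) := by
          unfold Nr
          congr 1
          ext x
          beta_reduce
          rw [abs_of_nonneg (hG0 m x), abs_of_nonneg (hsum0 x),
            ← ENNReal.ofReal_add (hG0 m x) (hsum0 x), Finset.sum_range_succ',
            abs_of_nonneg (add_nonneg (Finset.sum_nonneg fun i _ => hG0 _ x) (hG0 _ x)), add_comm]
          simp [add_assoc, add_comm 1]
      _ ≤ ENNReal.ofReal X.C * (X.Nr (G m) +
            X.Nr (fun x => ∑ i ∈ Finset.range k, G (m + 1 + i) x)) :=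
          X.quasi_triangle _ _ (hG m).abs.ennreal_ofReal hmeas.abs.ennreal_ofReal
      _ ≤ ENNReal.ofReal X.C * (ENNReal.ofReal ((2 * X.C)⁻¹ ^ m) * K +
            ENNReal.ofReal (2 * X.C * (2 * X.C)⁻¹ ^ (m + 1)) * K) := by
          gcongr
          · exact hK m
          · exact ih (m + 1)
      _ = ENNReal.ofReal (2 * X.C * (2 * X.C)⁻¹ ^ m) * K := by
          rw [← add_mul, ← mul_assoc, ← ENNReal.ofReal_add (by positivity) (by positivity),
            ← ENNReal.ofReal_mul (by positivity)]
          congr 2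
          have h1 : X.C * (2 * X.C)⁻¹ = 1 / 2 := by field_simp
          rw [pow_succ]
          linear_combination 2 * X.C * (2 * X.C)⁻¹ ^ m * h1

/-- A countable supremum of functions with rapidly decreasing quasi-norms is controlled
in `X`, by completeness. -/
lemma N_le_of_le_iSup (X : RIQB) {G : ℕ → ℝ → ℝ} (hG : ∀ n, AEMeasurable (G n) volume)
    (hG0 : ∀ n x, 0 ≤ G n x) {K : ℝ≥0∞} (hKtop : K < ∞)
    (hK : ∀ n, X.Nr (G n) ≤ ENNReal.ofReal ((2 * X.C)⁻¹ ^ n) * K)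
    {h : ℝ → ℝ≥0∞} (hh : AEMeasurable h volume)
    (hle : ∀ x, h x ≤ ⨆ n, ENNReal.ofReal (G n x)) :
    X.N h ≤ ENNReal.ofReal (2 * X.C ^ 2) * K := by
  have hC := X.one_le_C
  let S : ℕ → ℝ → ℝ := fun n x => ∑ i ∈ Finset.range n, G i x
  have hS (n) : AEMeasurable (S n) volume := Finset.aemeasurable_fun_sum _ fun i _ => hG i
  have hSN (n) : X.N (fun x => ENNReal.ofReal |S n x|) ≤ ENNReal.ofReal (2 * X.C) * K := by
    simpa [Nr, S] using X.N_sum_range_le hG hG0 hK n 0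
  have hdiff {m n : ℕ} (hmn : m ≤ n) : X.N (fun x => ENNReal.ofReal |S n x - S m x|) ≤
      ENNReal.ofReal (2 * X.C * (2 * X.C)⁻¹ ^ m) * K := by
    obtain ⟨k, rfl⟩ := Nat.exists_eq_add_of_le hmn
    simpa [Nr, S, Finset.sum_range_add] using X.N_sum_range_le hG hG0 hK k m
  have hlim : Tendsto (fun m : ℕ => ENNReal.ofReal (2 * X.C * (2 * X.C)⁻¹ ^ m) * K) atTop
      (𝓝 0) := by
    have hpow : Tendsto (fun m : ℕ => (2 * X.C)⁻¹ ^ m) atTop (𝓝 0) :=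
      tendsto_pow_atTop_nhds_zero_of_lt_one (by positivity) (inv_lt_one_of_one_lt₀ (by linarith))
    simpa using ENNReal.Tendsto.mul_const
      (ENNReal.tendsto_ofReal (hpow.const_mul (2 * X.C))) (Or.inr hKtop.ne)
  obtain ⟨g, hg, -, hlimg⟩ := X.complete S
    (fun n => ⟨hS n, (hSN n).trans_lt (ENNReal.mul_lt_top ENNReal.ofReal_lt_top hKtop)⟩) <| by
      intro ε hε
      obtain ⟨M, hM⟩ := eventually_atTop.1
        (hlim.eventually (gt_mem_nhds (ENNReal.ofReal_pos.2 hε)))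
      refine ⟨M, fun m hm n hn => ?_⟩
      rcases le_total m n with hmn | hmn
      · simp_rw [abs_sub_comm (S m _)]
        exact (hdiff hmn).trans_lt (hM m hm)
      · exact (hdiff hmn).trans_lt (hM n hn)
  have hGg (m) : ∀ᵐ x, G m x ≤ g x := by
    have hmeas : AEMeasurable (fun x => ENNReal.ofReal (G m x - g x)) volume :=
      ((hG m).sub hg).ennreal_ofReal
    have hzero : X.N (fun x => ENNReal.ofReal (G m x - g x)) = 0 := by
      refine le_antisymm (ge_of_tendsto hlimg (eventually_atTop.2 ⟨m + 1, fun n hn => ?_⟩)) zero_le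
      refine X.N_mono_ae ((hS n).sub hg).abs.ennreal_ofReal hmeas (ae_of_all _ fun x => ?_)
      refine ENNReal.ofReal_le_ofReal ((sub_le_sub_right ?_ _).trans (le_abs_self _))
      exact Finset.single_le_sum (f := fun i => G i x) (fun i _ => hG0 i x)
        (Finset.mem_range.2 (by omega))
    filter_upwards [(X.definite _ hmeas).1 hzero] with x hx
    simpa using hx
  have hhg : X.N h ≤ X.N (fun x => ENNReal.ofReal |g x|) := by
    refine X.N_mono_ae hg.abs.ennreal_ofReal hh ?_
    filter_upwards [ae_all_iff.2 hGg] with x hx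
    exact (hle x).trans (iSup_le fun n => ENNReal.ofReal_le_ofReal ((hx n).trans (le_abs_self _)))
  have hbound (n) : X.N h ≤ ENNReal.ofReal X.C *
      (X.N (fun x => ENNReal.ofReal |S n x - g x|) + ENNReal.ofReal (2 * X.C) * K) := by
    have hm1 := ((hS n).sub hg).abs.ennreal_ofReal
    have hm2 := (hS n).abs.ennreal_ofReal
    calc X.N h ≤ X.N (fun x => ENNReal.ofReal |g x|) := hhg
      _ ≤ X.N (fun x => ENNReal.ofReal |S n x - g x| + ENNReal.ofReal |S n x|) := by
          refine X.N_mono_ae (hm1.add hm2) hg.abs.ennreal_ofReal (ae_of_all _ fun x => ?_)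
          beta_reduce
          rw [← ENNReal.ofReal_add (abs_nonneg _) (abs_nonneg _)]
          refine ENNReal.ofReal_le_ofReal ?_
          rw [abs_sub_comm]
          simpa using abs_add_le (g x - S n x) (S n x)
      _ ≤ _ := X.quasi_triangle _ _ hm1 hm2
      _ ≤ _ := by gcongr; exact hSN n
  have hfin := ge_of_tendsto' (ENNReal.Tendsto.const_mul (a := ENNReal.ofReal X.C)
    (hlimg.add_const (ENNReal.ofReal (2 * X.C) * K)) (Or.inr ENNReal.ofReal_ne_top)) hbound
  refine hfin.trans_eq ?_
  rw [zero_add, ← mul_assoc, ← ENNReal.ofReal_mul (by positivity)]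
  ring_nf

end RIQB

lemma antitoneOn_hardyUSup (p : ℝ) (f : ℝ → ℝ) :
    AntitoneOn (hardyUSup p f) (Ioi 0) := by
  intro t (ht : 0 < t) t' (ht' : 0 < t') htt'
  simp only [hardyUSup, ht, ht', if_true]
  refine iSup₂_le fun s hs => ?_
  have hs0 : 0 < s := hs.1
  have hmem : s / t' * t ∈ Ioo 0 t :=
    ⟨by positivity, mul_lt_of_lt_one_left ht ((div_lt_one ht').2 hs.2)⟩
  refine le_trans ?_ (le_iSup₂ (f := fun s _ => ENNReal.ofReal ((s/t) ^ (1/p)) * rearr f s) _ hmem)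
  rw [mul_div_cancel_right₀ _ ht.ne']
  gcongr
  refine rearrE_antitone _ ?_
  rw [div_mul_eq_mul_div, div_le_iff₀ ht']
  gcongr

lemma aemeasurable_hardyUSup (p : ℝ) (f : ℝ → ℝ) :
    AEMeasurable (hardyUSup p f) volume := by
  have hind : (Ioi (0 : ℝ)).indicator (hardyUSup p f) = hardyUSup p f :=
    indicator_eq_self.2 fun t ht => by
      by_contra hneg
      exact ht (if_neg hneg)
  rw [← hind, aemeasurable_indicator_iff measurableSet_Ioi]
  exact aemeasurable_restrict_of_antitoneOn measurableSet_Ioi (antitoneOn_hardyUSup p f)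

/-- **Theorem 2 (iii).** If `p_X > p` then `H^{(p,∞)}` is bounded on `X`. -/
theorem hardyUSup_bounded_of_lt_lowerBoyd (X : RIQB) (p : ℝ) (hp : 0 < p)
    (hpX : ENNReal.ofReal p < lowerBoyd X) :
    ∃ c : ℝ, 0 < c ∧ ∀ f : ℝ → ℝ, X.mem f →
      X.N (hardyUSup p f) ≤ ENNReal.ofReal c * X.Nr f := by
  obtain ⟨q, ⟨hq, c, hc, hdil⟩, hpq⟩ := lt_biSup_iff.1 hpX
  have hpq : p < q := (ENNReal.ofReal_lt_ofReal_iff hq).1 hpq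
  have hC := X.one_le_C
  have hδ : 0 < 1 / p - 1 / q := sub_pos.2 (one_div_lt_one_div_of_lt hp hpq)
  obtain ⟨y, hy0, hy1, hyC⟩ : ∃ y : ℝ, 0 < y ∧ y < 1 ∧ y ^ (1 / p - 1 / q) = (2 * X.C)⁻¹ :=
    ⟨((2 * X.C)⁻¹) ^ (1 / p - 1 / q)⁻¹, by positivity,
      Real.rpow_lt_one (by positivity) (inv_lt_one_of_one_lt₀ (by linarith)) (by positivity),
      Real.rpow_inv_rpow (by positivity) hδ.ne'⟩
  refine ⟨2 * X.C ^ 2 * (c * y ^ (-(1 / q))), by positivity, fun f ⟨hf, hfN⟩ => ?_⟩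
  have hf' : AEMeasurable (fun x => ENNReal.ofReal |f x|) volume := hf.abs.ennreal_ofReal
  let F : ℝ → ℝ := (Ioi 0).indicator fun x => (rearr f x).toReal
  have hF : Measurable F :=
    (rearrE_antitone _).measurable.ennreal_toReal.indicator measurableSet_Ioi
  have hF0 (x) : 0 ≤ F x := indicator_nonneg (fun _ _ => ENNReal.toReal_nonneg) x
  have hFpos {x : ℝ} (hx : 0 < x) : ENNReal.ofReal (F x) = rearr f x := by
    simp only [F, indicator_of_mem (mem_Ioi.2 hx)]
    exact ENNReal.ofReal_toReal (X.rearrE_lt_top hf' hfN hx).ne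
  have hFN : X.Nr F ≤ X.Nr f := by
    refine X.rearr_mono _ _ hf' hF.abs.ennreal_ofReal.aemeasurable fun s _ =>
      rearrE_le_of_measure_le (fun t => ?_) s
    refine (measure_mono fun x hx => ?_).trans (volume_lt_rearrE_le _ t)
    rw [mem_ofPred_eq, abs_of_nonneg (hF0 x)] at hx
    by_cases hx0 : 0 < x
    · exact ⟨hx0, by rwa [hFpos hx0] at hx⟩
    · simp [F, hx0] at hx
  have hkey := X.N_le_of_le_iSup (G := fun n x => (y ^ n) ^ (1 / p) * F (y ^ (n + 1) * x))
    (K := ENNReal.ofReal (c * y ^ (-(1 / q))) * X.Nr f) (h := hardyUSup p f)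
    (fun n => ((hF.comp (measurable_const_mul _)).const_mul _).aemeasurable)
    (fun n x => mul_nonneg (by positivity) (hF0 _))
    (ENNReal.mul_lt_top ENNReal.ofReal_lt_top hfN) ?_ (aemeasurable_hardyUSup p f) ?_
  · rwa [← mul_assoc, ← ENNReal.ofReal_mul (by positivity)] at hkey
  · intro n
    calc X.Nr (fun x => (y ^ n) ^ (1 / p) * F (y ^ (n + 1) * x))
        = ENNReal.ofReal ((y ^ n) ^ (1 / p)) * X.Nr (dil (y ^ (n + 1)) F) := by
          unfold RIQB.Nr
          rw [← X.norm_smul]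
          congr 1
          ext x
          rw [abs_mul, abs_of_nonneg (by positivity), ENNReal.ofReal_mul (by positivity)]
          rfl
      _ ≤ ENNReal.ofReal ((y ^ n) ^ (1 / p)) *
            (ENNReal.ofReal (c * (y ^ (n + 1)) ^ (-(1 / q))) * X.Nr f) := by
          gcongr
          refine (hdil _ (by positivity) (pow_lt_one₀ hy0.le hy1 n.succ_ne_zero) F
            hF.aemeasurable (hFN.trans_lt hfN)).trans ?_
          gcongr
      _ = _ := by
          rw [← mul_assoc, ← mul_assoc, ← ENNReal.ofReal_mul (by positivity),
            ← ENNReal.ofReal_mul (by positivity), ← hyC]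
          congr 2
          simp only [← Real.rpow_natCast, ← Real.rpow_mul hy0.le]
          rw [mul_left_comm, mul_left_comm _ c, ← Real.rpow_add hy0, ← Real.rpow_add hy0]
          push_cast
          ring_nf
  · intro t
    by_cases ht : 0 < t
    swap
    · simp [hardyUSup, ht]
    simp only [hardyUSup, ht, if_true]
    refine iSup₂_le fun s hs => ?_
    have hs0 : 0 < s := hs.1
    obtain ⟨n, hn1, hn2⟩ := exists_nat_pow_near_of_lt_one (div_pos hs0 ht)
      ((div_lt_one ht).2 hs.2).le hy0 hy1
    refine le_iSup_of_le n ?_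
    rw [ENNReal.ofReal_mul (by positivity), hFpos (by positivity)]
    gcongr
    exact rearrE_antitone _ ((lt_div_iff₀ ht).1 hn1).le

end
end
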